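/- Let G = (V,E) be a finite simple graph with n = |V|, and let 𝒢 be the graph obtained from G by the subdivision-path-apex construction. If 𝒮 is a proper stalled subset of 𝒢 with |𝒮| ≥ (2n+1)·|E| + 2 and ε ∈ 𝒮, then 𝒮 ∩ V is a union of vertex sets of connected components of G (equivalently, no edge of G joins a vertex of 𝒮 ∩ V to a vertex of V \ 𝒮). -/

import Mathlib

/-- An empty vertex `v` is forced by the filled set `F` if some filled vertex `u ∈ F`
adjacent to `v` has `v` as its unique neighbor outside `F`. -/
def IsForced {W : Type*} (H : SimpleGraph W) (F : Set W) (v : W) : Prop :=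
  v ∉ F ∧ ∃ u, u ∈ F ∧ H.Adj u v ∧ ∀ w, H.Adj u w → w ∉ F → w = v

/-- An empty vertex `v` is skew forced by `F` if some vertex `u` (filled or not)
adjacent to `v` has `v` as its unique neighbor outside `F`. -/
def IsSkewForced {W : Type*} (H : SimpleGraph W) (F : Set W) (v : W) : Prop :=
  v ∉ F ∧ ∃ u, H.Adj u v ∧ ∀ w, H.Adj u w → w ∉ F → w = v

/-- `F` is stalled if no empty vertex is forced by `F`. -/
def Stalled {W : Type*} (H : SimpleGraph W) (F : Set W) : Prop :=
  ∀ v, ¬ IsForced H F v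

/-- `F` is skew stalled if no empty vertex is skew forced by `F`. -/
def SkewStalled {W : Type*} (H : SimpleGraph W) (F : Set W) : Prop :=
  ∀ v, ¬ IsSkewForced H F v

/-- A set of vertices is independent if its vertices are pairwise non-adjacent. -/
def IndepIn {W : Type*} (H : SimpleGraph W) (U : Set W) : Prop :=
  U.Pairwise fun a b => ¬ H.Adj a b

/-- Vertex set of the subdivision-path-apex construction: the vertices of `G`,
vertices `e^i` for each edge `e` and `0 ≤ i ≤ 2n`, and one apex vertex `ε`. -/
abbrev GVert {V : Type*} [Fintype V] (G : SimpleGraph V) : Type _ :=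
  V ⊕ (G.edgeSet × Fin (2 * Fintype.card V + 1)) ⊕ Unit

/-- Generating relation: `v ~ e^0` when `v ∈ e`; `e^i ~ e^{i+1}`; `ε ~ e^0`. -/
def gRel {V : Type*} [Fintype V] (G : SimpleGraph V) : GVert G → GVert G → Prop
  | Sum.inl v, Sum.inr (Sum.inl (e, i)) => i.val = 0 ∧ v ∈ (e : Sym2 V)
  | Sum.inr (Sum.inl (e, i)), Sum.inr (Sum.inl (e', j)) => e = e' ∧ i.val + 1 = j.val
  | Sum.inr (Sum.inr _), Sum.inr (Sum.inl (_, i)) => i.val = 0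
  | _, _ => False

/-- The subdivision-path-apex construction `𝒢`. -/
def GG {V : Type*} [Fintype V] (G : SimpleGraph V) : SimpleGraph (GVert G) :=
  SimpleGraph.fromRel (gRel G)

/-- The vertex `e^i` of the construction. -/
abbrev pathVert {V : Type*} [Fintype V] {G : SimpleGraph V} (e : G.edgeSet)
    (i : Fin (2 * Fintype.card V + 1)) : GVert G :=
  Sum.inr (Sum.inl (e, i))

/-- In a stalled set, two consecutive filled vertices `e^i`, `e^{i+1}` of a path propagate
down to `e^0`, `e^1`. -/
lemma Stalled.pathVert_zero_one_mem {V : Type*} [Fintype V] {G : SimpleGraph V}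
    {S : Set (GVert G)} (hS : Stalled (GG G) S) (e : G.edgeSet) (i : ℕ)
    (hi : i + 1 < 2 * Fintype.card V + 1)
    (h₀ : pathVert e ⟨i, by omega⟩ ∈ S) (h₁ : pathVert e ⟨i + 1, hi⟩ ∈ S) :
    pathVert e ⟨0, by omega⟩ ∈ S ∧ pathVert e ⟨1, by omega⟩ ∈ S := by
  induction i with
  | zero => exact ⟨h₀, h₁⟩
  | succ i ih =>
    refine ih (by omega) ?_ h₀
    by_contra hn
    refine hS _ ⟨hn, _, h₀, ?_, ?_⟩
    · simp [GG, gRel]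
    · rintro (v | ⟨e', j⟩ | u) hadj hw
      · simp [GG, gRel] at hadj
      · simp only [GG, SimpleGraph.fromRel_adj, gRel] at hadj
        obtain ⟨-, ⟨rfl, hj⟩ | ⟨rfl, hj⟩⟩ := hadj
        · exact absurd (by convert h₁ using 5; exact hj.symm) hw
        · have : j = ⟨i, by omega⟩ := Fin.ext (by simpa using hj)
          rw [this]
      · simp [GG, gRel] at hadj

/-- If fewer than `n` vertices are empty, every path has two consecutive filled vertices. -/
lemma exists_consecutive_pathVert_mem {V : Type*} [Fintype V] {G : SimpleGraph V}
    {S : Set (GVert G)} (hS : Sᶜ.ncard < Fintype.card V) (e : G.edgeSet) :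
    ∃ (i : ℕ) (hi : i + 1 < 2 * Fintype.card V + 1),
      pathVert e ⟨i, by omega⟩ ∈ S ∧ pathVert e ⟨i + 1, hi⟩ ∈ S := by
  by_contra! hno
  have hex : ∀ k : Fin (Fintype.card V), ∃ j : Fin (2 * Fintype.card V + 1),
      j.val / 2 = k.val ∧ pathVert e j ∈ Sᶜ := by
    intro k
    by_cases h : pathVert e ⟨2 * k.val, by omega⟩ ∈ S
    · exact ⟨⟨2 * k.val + 1, by omega⟩, by simp only; omega, hno _ (by omega) h⟩
    · exact ⟨⟨2 * k.val, by omega⟩, by simp only; omega, h⟩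
  choose f hf hfS using hex
  have hinj : Function.Injective fun k => pathVert e (f k) := by
    intro k l hkl
    simp only [Sum.inr.injEq, Sum.inl.injEq, Prod.mk.injEq, true_and] at hkl
    exact Fin.ext (by rw [← hf k, ← hf l, hkl])
  have hle := Set.ncard_le_ncard (Set.range_subset_iff.mpr hfS) (Set.toFinite _)
  rw [← Set.image_univ, Set.ncard_image_of_injective _ hinj, Set.ncard_univ,
    Nat.card_eq_fintype_card, Fintype.card_fin] at hle
  omega

/-- If `ε`, `e^0` and `e^1` are filled in a stalled set, an endpoint of `e` being filled
makes the other endpoint filled. -/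
lemma Stalled.inl_mem_of_adj {V : Type*} [Fintype V] {G : SimpleGraph V}
    {S : Set (GVert G)} (hS : Stalled (GG G) S) (heps : (Sum.inr (Sum.inr ()) : GVert G) ∈ S)
    (hpath : ∀ e : G.edgeSet, ∃ h : 1 < 2 * Fintype.card V + 1,
      pathVert e ⟨0, by omega⟩ ∈ S ∧ pathVert e ⟨1, h⟩ ∈ S)
    {a b : V} (hab : G.Adj a b) (ha : (Sum.inl a : GVert G) ∈ S) :
    (Sum.inl b : GVert G) ∈ S := by
  obtain ⟨h, h₀, h₁⟩ := hpath ⟨s(a, b), hab⟩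
  by_contra hn
  refine hS _ ⟨hn, _, h₀, ?_, ?_⟩
  · simp [GG, gRel]
  · rintro (v | ⟨e', j⟩ | u) hadj hw
    · simp only [GG, SimpleGraph.fromRel_adj, gRel, Sym2.mem_iff] at hadj
      obtain ⟨-, ⟨⟨⟩⟩ | ⟨-, rfl | rfl⟩⟩ := hadj
      · exact absurd ha hw
      · rfl
    · simp only [GG, SimpleGraph.fromRel_adj, gRel] at hadj
      obtain ⟨-, ⟨rfl, hj⟩ | ⟨rfl, hj⟩⟩ := hadj
      · exact absurd (by convert h₁ using 5; simpa using hj.symm) hw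
      · simp at hj
    · exact absurd heps hw

/-- a proper stalled subset of `𝒢` of cardinality at least `(2n+1)·|E| + 2`
containing `ε` meets `V` in a union of connected components of `G`: no edge of `G`
joins a vertex of `𝒮 ∩ V` to a vertex of `V \\ 𝒮`. -/
theorem stalled_with_eps_components {V : Type*} [Fintype V] (G : SimpleGraph V)
    (S : Set (GVert G)) (hS : Stalled (GG G) S) (hproper : S ≠ Set.univ)
    (hcard : (2 * Fintype.card V + 1) * G.edgeSet.ncard + 2 ≤ S.ncard)
    (heps : (Sum.inr (Sum.inr ()) : GVert G) ∈ S) :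
    ∀ a b : V, G.Adj a b → ((Sum.inl a : GVert G) ∈ S ↔ (Sum.inl b : GVert G) ∈ S) := by
  have hempty : Sᶜ.ncard < Fintype.card V := by
    have hsum := Set.ncard_add_ncard_compl S
    have htotal : Nat.card (GVert G) =
        Fintype.card V + (G.edgeSet.ncard * (2 * Fintype.card V + 1) + 1) := by
      rw [Nat.card_sum, Nat.card_sum, Nat.card_prod, Nat.card_coe_set_eq]
      simp only [Nat.card_eq_fintype_card, Fintype.card_fin, Fintype.card_unit]
    rw [htotal, mul_comm G.edgeSet.ncard] at hsum
    omega
  have hpath : ∀ e : G.edgeSet, ∃ h : 1 < 2 * Fintype.card V + 1,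
      pathVert e ⟨0, by omega⟩ ∈ S ∧ pathVert e ⟨1, h⟩ ∈ S := by
    intro e
    obtain ⟨i, hi, h₀, h₁⟩ := exists_consecutive_pathVert_mem hempty e
    exact ⟨by omega, hS.pathVert_zero_one_mem e i hi h₀ h₁⟩
  exact fun a b hab => ⟨hS.inl_mem_of_adj heps hpath hab, hS.inl_mem_of_adj heps hpath hab.symm⟩
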